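/- arXiv:2003.06072 — 4 statements merged into one kernel-verified Lean document; each statement's English description precedes it below -/
import Mathlib

section
/- Let G be a finite group isomorphic to a direct product G₁ × G₂, where G₁ is a 2-group such that every coset of Z(G₁) in G₁ contains an element of order at most 2, and G₂ is an abelian group of odd order. Then α(G) = α(Z(G)). -/
/-- `α(G) = |C(G)| / |G|`, where `C(G)` is the set of cyclic subgroups of `G`. -/
noncomputable def alpha (G : Type*) [Group G] : ℚ :=
  (Nat.card {H : Subgroup G // IsCyclic H} : ℚ) / (Nat.card G : ℚ)

theorem Nat.totient_eq_of_div_gcd_two_eq {a b : ℕ} (h : a / a.gcd 2 = b / b.gcd 2) :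
    a.totient = b.totient := by
  have key : ∀ n : ℕ, n = n / n.gcd 2 ∧ Odd (n / n.gcd 2) ∨ n = 2 * (n / n.gcd 2) := by
    intro n
    rcases Nat.even_or_odd n with hn | hn
    · have : n.gcd 2 = 2 := Nat.gcd_eq_right hn.two_dvd
      right; rw [this]; exact (Nat.mul_div_cancel' hn.two_dvd).symm
    · have : n.gcd 2 = 1 := Nat.Coprime.gcd_eq_one (Nat.coprime_two_right.mpr hn)
      left; simpa [this] using hn
  have ha := key a
  have hb := key b
  rw [← h] at hb
  generalize a / a.gcd 2 = m at ha hb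
  rcases ha with ⟨rfl, ho⟩ | rfl <;> rcases hb with ⟨rfl, ho'⟩ | rfl
  · rfl
  · exact (Nat.totient_two_mul_of_odd ho).symm
  · exact Nat.totient_two_mul_of_odd ho'
  · rfl

theorem totient_orderOf_mul_eq {G : Type*} [Group G] [Finite G] {t z : G}
    (hc : Commute t z) (ht : t ^ 2 = 1) :
    (orderOf (t * z)).totient = (orderOf z).totient := by
  apply Nat.totient_eq_of_div_gcd_two_eq
  rw [← orderOf_pow, ← orderOf_pow, hc.mul_pow, ht, one_mul]

theorem card_generators_eq_totient {G : Type*} [Group G] [Fintype G] (H : Subgroup G)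
    [IsCyclic H] [DecidablePred fun g : G => Subgroup.zpowers g = H] :
    (Finset.univ.filter fun g : G => Subgroup.zpowers g = H).card = (Nat.card H).totient := by
  classical
  have := IsCyclic.card_orderOf_eq_totient (α := H) (d := Nat.card H) (by simp)
  rw [← this]
  symm
  refine Finset.card_bij (fun x _ => (x : G)) ?_ (fun _ _ _ _ h => Subtype.ext h) ?_
  · intro x hx
    simp only [Finset.mem_filter, Finset.mem_univ, true_and] at hx ⊢
    apply Subgroup.eq_of_le_of_card_ge
    · simp
    · rw [Nat.card_zpowers, Subgroup.orderOf_coe, hx]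
  · intro g hg
    simp only [Finset.mem_filter, Finset.mem_univ, true_and] at hg
    subst hg
    refine ⟨⟨g, Subgroup.mem_zpowers g⟩, ?_, rfl⟩
    simp only [Finset.mem_filter, Finset.mem_univ, true_and, Subgroup.orderOf_mk,
      Nat.card_zpowers]

theorem card_isCyclic_eq_sum (G : Type*) [Group G] [Fintype G] :
    (Nat.card {H : Subgroup G // IsCyclic H} : ℚ) =
      ∑ g : G, ((orderOf g).totient : ℚ)⁻¹ := by
  classical
  rw [← Finset.sum_fiberwise Finset.univ
    (fun g : G => (⟨Subgroup.zpowers g, inferInstance⟩ : {H : Subgroup G // IsCyclic H}))]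
  rw [Nat.card_eq_fintype_card, Fintype.card_eq_sum_ones, Nat.cast_sum]
  refine Finset.sum_congr rfl fun ⟨H, hH⟩ _ => ?_
  rw [Finset.sum_congr rfl (g := fun _ => ((Nat.card H).totient : ℚ)⁻¹)]
  · have hpos : ((Nat.card H).totient : ℚ) ≠ 0 := by
      exact_mod_cast (Nat.totient_pos.mpr Nat.card_pos).ne'
    simp only [Subtype.mk.injEq, Finset.sum_const, nsmul_eq_mul]
    rw [card_generators_eq_totient, mul_inv_cancel₀ hpos, Nat.cast_one]
  · intro g hg
    simp only [Finset.mem_filter, Finset.mem_univ, true_and, Subtype.mk.injEq] at hg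
    rw [← hg, Nat.card_zpowers]

theorem alpha_eq_alpha_center_of_sq_eq_one (G : Type*) [Group G] [Finite G]
    (h : ∀ g : G, ∃ z ∈ Subgroup.center G, (g * z) ^ 2 = 1) :
    alpha G = alpha (Subgroup.center G) := by
  classical
  have := Fintype.ofFinite G
  have hs : ∀ q : G ⧸ Subgroup.center G, ∃ t : G, (t : G ⧸ Subgroup.center G) = q ∧ t ^ 2 = 1 := by
    intro q
    obtain ⟨g, rfl⟩ := QuotientGroup.mk_surjective q
    obtain ⟨z, hz, hgz⟩ := h g
    exact ⟨g * z, QuotientGroup.mk_mul_of_mem g hz, hgz⟩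
  choose s hsq hs2 using hs
  have hbij : Function.Bijective
      (fun p : (G ⧸ Subgroup.center G) × Subgroup.center G => s p.1 * (p.2 : G)) := by
    constructor
    · rintro ⟨q, z⟩ ⟨q', z'⟩ hp
      simp only at hp
      have hq : q = q' := by
        rw [← hsq q, ← hsq q', ← QuotientGroup.mk_mul_of_mem (s q) z.2,
          ← QuotientGroup.mk_mul_of_mem (s q') z'.2, hp]
      subst hq
      simpa using hp
    · intro g
      refine ⟨⟨g, ⟨(s g)⁻¹ * g, QuotientGroup.eq.mp (hsq g)⟩⟩, by simp⟩
  have hsum : ∑ g : G, ((orderOf g).totient : ℚ)⁻¹ =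
      Nat.card (G ⧸ Subgroup.center G) *
        ∑ z : Subgroup.center G, ((orderOf z).totient : ℚ)⁻¹ := by
    rw [← hbij.sum_comp (fun g => ((orderOf g).totient : ℚ)⁻¹), Fintype.sum_prod_type]
    simp only [totient_orderOf_mul_eq (Subgroup.mem_center_iff.mp (Subtype.prop _) _) (hs2 _),
      Subgroup.orderOf_coe, Finset.sum_const, nsmul_eq_mul, Finset.card_univ,
      Nat.card_eq_fintype_card]
  have hq : (Nat.card (G ⧸ Subgroup.center G) : ℚ) ≠ 0 := by exact_mod_cast Nat.card_pos.ne'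
  rw [alpha, alpha, card_isCyclic_eq_sum, card_isCyclic_eq_sum, hsum,
    Subgroup.card_eq_card_quotient_mul_card_subgroup (Subgroup.center G), Nat.cast_mul,
    mul_div_mul_left _ _ hq]

/-- If `G ≅ G₁ × G₂` where `G₁` is a 2-group with every coset of `Z(G₁)` containing an
element of order at most 2, and `G₂` is abelian of odd order, then `α(G) = α(Z(G))`. -/
theorem alpha_eq_alpha_center_of_prod (G : Type*) [Group G] [Finite G]
    (G₁ : Type*) [Group G₁] [Finite G₁] (G₂ : Type*) [Group G₂] [Finite G₂]
    (h₁ : IsPGroup 2 G₁)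
    (h₁' : ∀ g : G₁, ∃ z ∈ Subgroup.center G₁, orderOf (g * z) ≤ 2)
    (h₂ : ∀ a b : G₂, a * b = b * a) (h₂' : Odd (Nat.card G₂))
    (e : G ≃* G₁ × G₂) :
    alpha G = alpha (Subgroup.center G) := by
  refine alpha_eq_alpha_center_of_sq_eq_one G fun g => ?_
  obtain ⟨z, hz, ho⟩ := h₁' (e g).1
  have hsq : ((e g).1 * z) ^ 2 = 1 := by
    have := orderOf_pos ((e g).1 * z)
    rw [← orderOf_dvd_iff_pow_eq_one]
    interval_cases orderOf ((e g).1 * z) <;> norm_num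
  refine ⟨e.symm (z, (e g).2⁻¹), ?_, ?_⟩
  · rw [Subgroup.mem_center_iff]
    intro x
    apply e.injective
    simp only [map_mul, MulEquiv.apply_symm_apply]
    exact Prod.ext (Subgroup.mem_center_iff.mp hz _) (h₂ _ _)
  · apply e.injective
    simp only [map_pow, map_mul, MulEquiv.apply_symm_apply, map_one]
    exact Prod.ext hsq (by simp)
end

section
/- Every finite group G with α(G) = α(Z(G)) is 4-abelian, i.e. (xy)⁴ = x⁴y⁴ for all x, y ∈ G. -/
open Finset in
/-- The number of cyclic subgroups of `G` is the sum of `1 / φ(o(x))` over `x : G`. -/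
theorem card_cyclic_subgroups_eq_sum (G : Type*) [Group G] [Fintype G] :
    (Nat.card {H : Subgroup G // IsCyclic H} : ℚ) =
      ∑ x : G, ((Nat.totient (orderOf x) : ℚ))⁻¹ := by
  classical
  have : Fintype {H : Subgroup G // IsCyclic H} := Fintype.ofFinite _
  let π : G → {H : Subgroup G // IsCyclic H} := fun x => ⟨Subgroup.zpowers x, inferInstance⟩
  rw [← Finset.sum_fiberwise (s := univ) (g := π), Nat.card_eq_fintype_card, ← card_univ,
    card_eq_sum_ones, Nat.cast_sum]
  refine sum_congr rfl fun H _ => ?_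
  obtain ⟨H, hH⟩ := H
  have horder : ∀ x ∈ univ.filter (fun x => π x = ⟨H, hH⟩), orderOf x = Nat.card H := by
    intro x hx
    have hx' : Subgroup.zpowers x = H := congrArg Subtype.val (mem_filter.1 hx).2
    rw [← Nat.card_zpowers, hx']
  have hcard : (univ.filter (fun x => π x = ⟨H, hH⟩)).card = Nat.totient (Nat.card H) := by
    have hgen := IsCyclic.card_orderOf_eq_totient (α := H) (d := Nat.card H)
      (by rw [Nat.card_eq_fintype_card])
    rw [← hgen]
    symm
    refine card_bij (fun x _ => (x : G)) ?_ (fun _ _ _ _ hxy => Subtype.ext hxy) ?_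
    · intro x hx
      simp only [mem_filter, mem_univ, true_and] at hx ⊢
      refine Subtype.ext ?_
      refine Subgroup.eq_of_le_of_card_ge (Subgroup.zpowers_le.2 x.2) ?_
      rw [Nat.card_zpowers, Subgroup.orderOf_coe, hx]
    · intro x hx
      have ho := horder x hx
      have hx' : Subgroup.zpowers x = H := congrArg Subtype.val (mem_filter.1 hx).2
      refine ⟨⟨x, hx' ▸ Subgroup.mem_zpowers x⟩, ?_, rfl⟩
      simp only [mem_filter, mem_univ, true_and]
      rwa [Subgroup.orderOf_mk]
  rw [sum_congr rfl fun x hx => by rw [horder x hx], sum_const, hcard, nsmul_eq_mul,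
    mul_inv_cancel₀, Nat.cast_one]
  exact_mod_cast (Nat.totient_pos.2 Nat.card_pos).ne'

/-- If the order of `x` does not divide that of `x * z` with `z` central, some central translate
of `x` has smaller order. -/
theorem exists_orderOf_mul_center_lt {G : Type*} [Group G] [Finite G] (x : G)
    (z : Subgroup.center G) (h : ¬ orderOf x ∣ orderOf (x * z)) :
    ∃ w : Subgroup.center G, orderOf (x * w) < orderOf x := by
  set n := orderOf x with hn
  set m := orderOf (x * z) with hm
  have hn0 : 0 < n := orderOf_pos x
  have hm0 : 0 < m := orderOf_pos _
  rw [Nat.dvd_iff_prime_pow_dvd_dvd] at h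
  push Not at h
  obtain ⟨p, k, hp, hkn, hkm⟩ := h
  obtain ⟨a, n', hpn', hna⟩ := Nat.exists_eq_pow_mul_and_not_dvd hn0.ne' p hp.ne_one
  obtain ⟨b, m', hpm', hmb⟩ := Nat.exists_eq_pow_mul_and_not_dvd hm0.ne' p hp.ne_one
  have hka : k ≤ a := by
    rw [hna] at hkn
    have hc : Nat.Coprime (p ^ k) n' := ((hp.coprime_iff_not_dvd).2 hpn').pow_left k
    exact (Nat.pow_dvd_pow_iff_le_right hp.one_lt).1 (hc.dvd_of_dvd_mul_right hkn)
  have hbk : b < k := by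
    by_contra hc
    exact hkm (hmb ▸ (pow_dvd_pow p (not_lt.1 hc)).mul_right m')
  obtain ⟨c, rfl⟩ : ∃ c, a = b + c + 1 := ⟨a - b - 1, by omega⟩
  have hcop : Nat.Coprime (p ^ (b + c + 1)) (n' * m') := by
    refine ((hp.coprime_iff_not_dvd).2 fun hd => ?_).pow_left _
    exact (hp.dvd_mul.1 hd).elim hpn' hpm'
  obtain ⟨s, t, hst⟩ := Nat.isCoprime_iff_coprime.2 hcop
  push_cast at hst
  have hcomm : Commute x (z : G) := (Subgroup.mem_center_iff.1 z.2 x)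
  set v : ℤ := t * (n' * m')
  set u : ℤ := s * p ^ (b + c + 1)
  have hw : x * ((z ^ v : Subgroup.center G) : G) = x ^ u * (x * z) ^ v := by
    rw [hcomm.mul_zpow, ← mul_assoc, ← zpow_add, hst, zpow_one, Subgroup.coe_zpow]
  have hxn : x ^ (n : ℤ) = 1 := by rw [zpow_natCast, hn, pow_orderOf_eq_one]
  have hym : (x * z) ^ (m : ℤ) = 1 := by rw [zpow_natCast, hm, pow_orderOf_eq_one]
  have hcomm' : Commute (x ^ u) ((x * z) ^ v) :=
    (((Commute.refl x).mul_right hcomm).zpow_zpow u v)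
  have hn'0 : 0 < n' := Nat.pos_of_ne_zero fun h0 => hpn' (h0 ▸ dvd_zero p)
  have hpow : (x * ((z ^ v : Subgroup.center G) : G)) ^ (p ^ (b + c) * n') = 1 := by
    rw [hw, hcomm'.mul_pow, ← zpow_natCast, ← zpow_natCast, ← zpow_mul, ← zpow_mul]
    have e1 : u * ((p ^ (b + c) * n' : ℕ) : ℤ) = n * (s * p ^ (b + c)) := by
      rw [hna]; push_cast; ring
    have e2 : v * ((p ^ (b + c) * n' : ℕ) : ℤ) = m * (t * n' * n' * p ^ c) := by
      rw [hmb]; push_cast; ring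
    rw [e1, e2, zpow_mul _ (n : ℤ), hxn, zpow_mul _ (m : ℤ), hym, one_zpow, one_zpow, one_mul]
  refine ⟨z ^ v, lt_of_le_of_lt (orderOf_le_of_pow_eq_one (by positivity [hp.pos]) hpow) ?_⟩
  rw [hna]
  exact Nat.mul_lt_mul_of_pos_right (Nat.pow_lt_pow_right hp.one_lt (Nat.lt_succ_self _)) hn'0

/-- Each coset of the center has an element whose order divides all orders in the coset. -/
theorem exists_orderOf_dvd_orderOf_mul_center {G : Type*} [Group G] [Finite G] (g : G) :
    ∃ w : Subgroup.center G, ∀ z : Subgroup.center G,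
      orderOf (g * w) ∣ orderOf (g * w * z) := by
  obtain ⟨w, hw⟩ := Finite.exists_min fun w : Subgroup.center G => orderOf (g * w)
  refine ⟨w, fun z => ?_⟩
  by_contra h
  obtain ⟨t, ht⟩ := exists_orderOf_mul_center_lt (g * w) z h
  have := hw (w * t)
  rw [Subgroup.coe_mul, ← mul_assoc] at this
  omega

/-- If the order of `x` divides the orders of all its central translates, then translating
a central element by `x` does not increase `1 / φ(o(·))`. -/
theorem inv_totient_orderOf_mul_le {G : Type*} [Group G] [Finite G] {x : G}
    (hx : ∀ z : Subgroup.center G, orderOf x ∣ orderOf (x * z)) (z : Subgroup.center G) :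
    ((Nat.totient (orderOf (x * z)) : ℚ))⁻¹ ≤ ((Nat.totient (orderOf z) : ℚ))⁻¹ := by
  have hcomm : Commute x (z : G) := (Subgroup.mem_center_iff.1 z.2 x)
  have hdvd : orderOf z ∣ orderOf (x * z) := by
    rw [← Subgroup.orderOf_coe, orderOf_dvd_iff_pow_eq_one]
    have h1 := pow_orderOf_eq_one (x * (z : G))
    rwa [hcomm.mul_pow, orderOf_dvd_iff_pow_eq_one.1 (hx z), one_mul] at h1
  have hpos : (0 : ℚ) < Nat.totient (orderOf z) := by
    exact_mod_cast Nat.totient_pos.2 (orderOf_pos z)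
  refine inv_anti₀ hpos ?_
  exact_mod_cast Nat.le_of_dvd (Nat.totient_pos.2 (orderOf_pos _)) (Nat.totient_dvd_of_dvd hdvd)

/-- If `α(G) = α(Z(G))`, each coset of the center has an element squaring to `1`. -/
theorem exists_mul_center_sq_eq_one {G : Type*} [Group G] [Finite G]
    (h : alpha G = alpha (Subgroup.center G)) (g : G) :
    ∃ w : Subgroup.center G, (g * w) ^ 2 = 1 := by
  classical
  have : Fintype G := Fintype.ofFinite G
  let f : G → ℚ := fun x => ((Nat.totient (orderOf x) : ℚ))⁻¹
  let f' : Subgroup.center G → ℚ := fun z => ((Nat.totient (orderOf z) : ℚ))⁻¹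
  have hshift : ∀ (g : G) (w : Subgroup.center G),
      ∑ z : Subgroup.center G, f (g * w * z) = ∑ z : Subgroup.center G, f (g * z) := by
    intro g w
    rw [← Equiv.sum_comp (Equiv.mulLeft w) (fun z : Subgroup.center G => f (g * z))]
    simp [mul_assoc]
  have hle : ∀ g ∈ (Finset.univ : Finset G),
      ∑ z : Subgroup.center G, f (g * z) ≤ ∑ z : Subgroup.center G, f' z := by
    intro g _
    obtain ⟨w, hw⟩ := exists_orderOf_dvd_orderOf_mul_center g
    rw [← hshift g w]
    exact Finset.sum_le_sum fun z _ => inv_totient_orderOf_mul_le hw z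
  have htotal : ∑ g : G, ∑ z : Subgroup.center G, f (g * z) =
      ∑ _g : G, ∑ z : Subgroup.center G, f' z := by
    have hG : (Nat.card G : ℚ) ≠ 0 := by exact_mod_cast Nat.card_pos.ne'
    have hZ : (Nat.card (Subgroup.center G) : ℚ) ≠ 0 := by exact_mod_cast Nat.card_pos.ne'
    rw [alpha, alpha, card_cyclic_subgroups_eq_sum, card_cyclic_subgroups_eq_sum,
      div_eq_div_iff hG hZ] at h
    rw [Finset.sum_comm]
    have hcol : ∀ z : Subgroup.center G, ∑ g : G, f (g * z) = ∑ g : G, f g := fun z =>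
      Equiv.sum_comp (Equiv.mulRight (z : G)) f
    simp only [hcol, Finset.sum_const, Finset.card_univ, nsmul_eq_mul,
      ← Nat.card_eq_fintype_card]
    rw [mul_comm, h, mul_comm]
  have heq := (Finset.sum_eq_sum_iff_of_le hle).1 htotal g (Finset.mem_univ g)
  obtain ⟨w, hw⟩ := exists_orderOf_dvd_orderOf_mul_center g
  refine ⟨w, ?_⟩
  rw [← hshift g w] at heq
  have h1 := (Finset.sum_eq_sum_iff_of_le fun z _ => inv_totient_orderOf_mul_le hw z).1 heq 1
    (Finset.mem_univ 1)
  simp only [OneMemClass.coe_one, mul_one, orderOf_one, Nat.totient_one, Nat.cast_one, inv_one,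
    inv_eq_one, Nat.cast_eq_one, Nat.totient_eq_one_iff] at h1
  refine orderOf_dvd_iff_pow_eq_one.1 ?_
  rcases h1 with h1 | h1 <;> simp [h1]

/-- A product of two involutions (or trivial elements) with central square has fourth power `1`. -/
theorem mul_pow_four_eq_one_of_sq_mem_center {G : Type*} [Group G] {a b : G}
    (ha : a ^ 2 = 1) (hb : b ^ 2 = 1) (hab : (a * b) ^ 2 ∈ Subgroup.center G) :
    (a * b) ^ 4 = 1 := by
  have h1 : a * (a * b) ^ 2 = (a * b) ^ 2 * a := Subgroup.mem_center_iff.1 hab a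
  calc (a * b) ^ 4 = (a * b) ^ 2 * a * (b * a * b) := by
        simp only [pow_succ, pow_zero, one_mul, mul_assoc]
    _ = a * (a * b) ^ 2 * (b * a * b) := by rw [h1]
    _ = a ^ 2 * (b * (a * (b ^ 2 * a)) * b) := by simp only [pow_two, mul_assoc]
    _ = 1 := by rw [ha, hb, one_mul, one_mul, ← pow_two, ha, mul_one, ← pow_two, hb]

/-- Every finite group `G` with `α(G) = α(Z(G))` is 4-abelian:
`(xy)⁴ = x⁴y⁴` for all `x, y ∈ G`. -/
theorem four_abelian_of_alpha_eq (G : Type*) [Group G] [Finite G]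
    (h : alpha G = alpha (Subgroup.center G)) :
    ∀ x y : G, (x * y) ^ 4 = x ^ 4 * y ^ 4 := by
  intro x y
  have hcomm : ∀ (g : G) (z : Subgroup.center G), Commute g (z : G) := fun g z =>
    Subgroup.mem_center_iff.1 z.2 g
  have hpow : ∀ (g : G) (z : Subgroup.center G), (g * z) ^ 4 = 1 →
      g ^ 4 = ((z : G) ^ 4)⁻¹ := by
    intro g z hz
    rw [(hcomm g z).mul_pow] at hz
    exact eq_inv_of_mul_eq_one_left hz
  obtain ⟨u, hu⟩ := exists_mul_center_sq_eq_one h x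
  obtain ⟨v, hv⟩ := exists_mul_center_sq_eq_one h y
  obtain ⟨w, hw⟩ := exists_mul_center_sq_eq_one h (x * u * (y * v))
  have hcen : (x * u * (y * v)) ^ 2 ∈ Subgroup.center G := by
    rw [(hcomm _ w).mul_pow] at hw
    rw [eq_inv_of_mul_eq_one_left hw]
    exact inv_mem (pow_mem w.2 2)
  have hprod := mul_pow_four_eq_one_of_sq_mem_center hu hv hcen
  have hrw : x * u * (y * v) = x * y * ((u * v : Subgroup.center G) : G) := by
    rw [Subgroup.coe_mul, mul_assoc, ← mul_assoc (u : G), ← (hcomm y u).eq]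
    simp only [mul_assoc]
  rw [hrw] at hprod
  have hx : (x * u) ^ 4 = 1 := by rw [show 4 = 2 * 2 from rfl, pow_mul, hu, one_pow]
  have hy : (y * v) ^ 4 = 1 := by rw [show 4 = 2 * 2 from rfl, pow_mul, hv, one_pow]
  rw [hpow _ _ hprod, hpow _ _ hx, hpow _ _ hy, Subgroup.coe_mul, (hcomm (u : G) v).mul_pow,
    mul_inv_rev, ((hcomm (u : G) v).pow_pow 4 4).inv_inv.eq]
end

section
/- Let G be a finite group, y ∈ G an element whose order is minimal among the orders of elements of the coset yZ(G), and x ∈ Z(G). Then φ(o(x)) divides φ(o(yx)); in particular, φ(o(x)) ≤ φ(o(yx)). -/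
/-- A prime power dividing a least common multiple divides one of the two numbers. -/
theorem Nat.Prime.pow_dvd_or_pow_dvd_of_dvd_lcm {p : ℕ} (hp : p.Prime) {a m n : ℕ}
    (hm : m ≠ 0) (hn : n ≠ 0) (h : p ^ a ∣ m.lcm n) : p ^ a ∣ m ∨ p ^ a ∣ n := by
  rw [hp.pow_dvd_iff_le_factorization (Nat.lcm_ne_zero hm hn),
    Nat.factorization_lcm hm hn, Finsupp.sup_apply, le_sup_iff] at h
  rwa [hp.pow_dvd_iff_le_factorization hm, hp.pow_dvd_iff_le_factorization hn]

/-- An element `x` of finite order has a power `z`, its `p`-part, with order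
the `p`-part of the order of `x` and such that `x⁻¹ * z` has order coprime to `p`. -/
theorem exists_pow_orderOf_eq_ordProj {G : Type*} [Group G] [Finite G] (x : G) {p : ℕ}
    (hp : p.Prime) :
    ∃ k : ℕ, orderOf (x ^ k) = p ^ (orderOf x).factorization p ∧
      (orderOf (x⁻¹ * x ^ k)).Coprime p := by
  set q := p ^ (orderOf x).factorization p with hq
  set m := orderOf x / q with hm
  have hqm : q * m = orderOf x := Nat.ordProj_mul_ordCompl_eq_self _ _
  have hpm : m.Coprime p := (Nat.coprime_ordCompl hp (orderOf_pos x).ne').symm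
  have hco : q.Coprime m := (hpm.pow_right _).symm
  obtain ⟨k, hk1, hk0⟩ := Nat.chineseRemainder hco 1 0
  have hd : orderOf (x⁻¹ * x ^ k) ∣ m := by
    rw [orderOf_dvd_iff_pow_eq_one,
      ((Commute.refl x).inv_left.pow_right k).mul_pow, inv_pow, inv_mul_eq_one, ← pow_mul,
      pow_eq_pow_iff_modEq, ← hqm]
    simpa using (hk1.mul_right' m).symm
  refine ⟨k, Nat.dvd_antisymm ?_ ?_, hpm.coprime_dvd_left hd⟩
  · rw [orderOf_dvd_iff_pow_eq_one, ← pow_mul, ← orderOf_dvd_iff_pow_eq_one, ← hqm, mul_comm]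
    exact Nat.mul_dvd_mul_right ((Nat.modEq_zero_iff_dvd).1 hk0) q
  · have hx : orderOf x ∣ (orderOf (x ^ k)).lcm (orderOf (x⁻¹ * x ^ k)) := by
      have h := ((Commute.pow_self x k).inv_right.mul_right
        (Commute.refl (x ^ k))).inv_right.orderOf_mul_dvd_lcm
      rwa [orderOf_inv, mul_inv_rev, inv_inv, mul_inv_cancel_left] at h
    exact hco.dvd_of_dvd_mul_right (((Dvd.intro _ hqm).trans hx).trans
      ((Nat.lcm_dvd_mul _ _).trans (Nat.mul_dvd_mul_left _ hd)))

/-- If `y` has minimal order in its coset of the center, then the order of a central `x`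
divides the order of `y * x`. -/
theorem orderOf_dvd_orderOf_mul_of_min_order {G : Type*} [Group G] [Finite G] {y : G}
    (hy : ∀ z ∈ Subgroup.center G, orderOf y ≤ orderOf (y * z))
    {x : G} (hx : x ∈ Subgroup.center G) : orderOf x ∣ orderOf (y * x) := by
  have pos (g : G) : orderOf g ≠ 0 := (orderOf_pos g).ne'
  have comm {c : G} (hc : c ∈ Subgroup.center G) (g : G) : Commute g c :=
    Subgroup.mem_center_iff.1 hc g
  rw [← Nat.factorization_le_iff_dvd (pos _) (pos _)]
  intro p
  by_cases hp : p.Prime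
  swap
  · simp [Nat.factorization_eq_zero_of_not_prime _ hp]
  rw [← hp.pow_dvd_iff_le_factorization (pos _)]
  by_contra hn
  obtain ⟨k, hz, hco⟩ := exists_pow_orderOf_eq_ordProj x hp
  set q := p ^ (orderOf x).factorization p
  set z := x ^ k
  have hzc : z ∈ Subgroup.center G := pow_mem hx k
  have hyz : ¬ q ∣ orderOf (y * z) := fun h ↦ by
    have hd := (comm (mul_mem (inv_mem hx) hzc) (y * x)).orderOf_mul_dvd_lcm
    rw [mul_assoc, mul_inv_cancel_left] at hd
    exact hn ((hco.pow_right _).symm.dvd_of_dvd_mul_right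
      ((h.trans hd).trans (Nat.lcm_dvd_mul _ _)))
  have hqy : q ∣ orderOf y := by
    have hd := ((Commute.refl y).mul_right (comm hzc y)).inv_left.orderOf_mul_dvd_lcm
    rw [inv_mul_cancel_left, orderOf_inv, hz] at hd
    exact (hp.pow_dvd_or_pow_dvd_of_dvd_lcm (pos _) (pos _) hd).resolve_right hyz
  have hdvd : orderOf (y * z) ∣ orderOf y := by
    have hd := (comm hzc y).orderOf_mul_dvd_lcm
    exact hd.trans (Nat.lcm_dvd dvd_rfl (hz ▸ hqy))
  exact hyz (Nat.le_antisymm (hy z hzc) (Nat.le_of_dvd (orderOf_pos y) hdvd) ▸ hqy)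


/-- If `y ∈ G` has minimal order among the elements of the coset `yZ(G)` and
`x ∈ Z(G)`, then `φ(o(x)) ∣ φ(o(yx))`; in particular `φ(o(x)) ≤ φ(o(yx))`. -/
theorem totient_orderOf_dvd_of_min_order (G : Type*) [Group G] [Finite G] (y : G)
    (hy : ∀ z ∈ Subgroup.center G, orderOf y ≤ orderOf (y * z))
    (x : G) (hx : x ∈ Subgroup.center G) :
    Nat.totient (orderOf x) ∣ Nat.totient (orderOf (y * x)) ∧
      Nat.totient (orderOf x) ≤ Nat.totient (orderOf (y * x)) := by
  have h := Nat.totient_dvd_of_dvd (orderOf_dvd_orderOf_mul_of_min_order hy hx)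
  exact ⟨h, Nat.le_of_dvd (Nat.totient_pos.2 (orderOf_pos _)) h⟩
end

section
/- Let G be a finite group with α(G) = α(Z(G)). Then for every odd prime p, every Sylow p-subgroup of G is contained in the center Z(G). -/
open Finset in
/-- A finite cyclic subgroup `H` has exactly `φ(|H|)` generators. -/
theorem card_filter_zpowers_eq {G : Type*} [Group G] [Fintype G] [DecidableEq (Subgroup G)]
    (H : Subgroup G) [IsCyclic H] :
    #{x : G | Subgroup.zpowers x = H} = (Nat.card H).totient := by
  classical
  have hH : Nat.card H = Fintype.card H := Nat.card_eq_fintype_card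
  rw [hH, ← IsCyclic.card_orderOf_eq_totient (α := H) dvd_rfl,
    ← card_map (Function.Embedding.subtype (· ∈ H))]
  congr 1
  ext x
  simp only [mem_filter, mem_univ, true_and, mem_map, Function.Embedding.subtype_apply]
  constructor
  · intro hx
    have hxH : x ∈ H := hx ▸ Subgroup.mem_zpowers x
    refine ⟨⟨x, hxH⟩, ?_, rfl⟩
    rw [Subgroup.orderOf_mk, ← hH, ← Nat.card_zpowers, hx]
  · rintro ⟨a, ha, rfl⟩
    refine Subgroup.eq_of_le_of_card_ge (Subgroup.zpowers_le.2 a.2) ?_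
    rw [Nat.card_zpowers, Subgroup.orderOf_coe, ha, hH]

/-- The number of cyclic subgroups of `G` is `∑ x, 1 / φ(o(x))`. -/
theorem card_isCyclic_subgroup_eq_sum (G : Type*) [Group G] [Fintype G] :
    (Nat.card {H : Subgroup G // IsCyclic H} : ℚ) = ∑ x : G, ((orderOf x).totient : ℚ)⁻¹ := by
  classical
  have : Fintype {H : Subgroup G // IsCyclic H} := Fintype.ofFinite _
  let c : G → {H : Subgroup G // IsCyclic H} := fun x => ⟨Subgroup.zpowers x, inferInstance⟩
  rw [← Finset.sum_fiberwise Finset.univ c, Nat.card_eq_fintype_card, Fintype.card_eq_sum_ones,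
    Nat.cast_sum]
  refine Finset.sum_congr rfl fun H _ => ?_
  have hcyc : IsCyclic H.1 := H.2
  have hpos : ((Nat.card H.1).totient : ℚ) ≠ 0 := by
    exact_mod_cast (Nat.totient_pos.2 Nat.card_pos).ne'
  have hterm : ∀ x ∈ Finset.univ.filter (fun x => c x = H),
      ((orderOf x).totient : ℚ)⁻¹ = ((Nat.card H.1).totient : ℚ)⁻¹ := by
    intro x hx
    have hx' : Subgroup.zpowers x = H.1 := congrArg Subtype.val (Finset.mem_filter.1 hx).2
    rw [← Nat.card_zpowers, hx']
  have hcard := card_filter_zpowers_eq H.1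
  rw [Finset.sum_congr rfl hterm, Finset.sum_const, nsmul_eq_mul]
  simp only [c, Subtype.ext_iff]
  rw [hcard, mul_inv_cancel₀ hpos, Nat.cast_one]

/-- The coset of `g` modulo a subgroup containing a commuting element `z` contains an element
whose order divides both the orders of `g` and `g * z`. -/
theorem Commute.exists_orderOf_mul_zpow_dvd_gcd {G : Type*} [Group G] {g z : G}
    (hgz : Commute g z) :
    ∃ k : ℤ, orderOf (g * z ^ k) ∣ (orderOf g).gcd (orderOf (g * z)) := by
  set m := orderOf g with hm
  set n := orderOf (g * z) with hn
  rcases Nat.eq_zero_or_pos (m.gcd n) with h0 | h0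
  · exact ⟨0, by rw [h0]; exact dvd_zero _⟩
  obtain ⟨a, ha⟩ := Nat.gcd_dvd_left m n
  obtain ⟨b, hb⟩ := Nat.gcd_dvd_right m n
  have hbez := Nat.gcd_eq_gcd_ab m n
  set s := Nat.gcdA m n
  set t := Nat.gcdB m n
  set d := m.gcd n
  have hab : (a : ℤ) * s + b * t = 1 := by
    have hd : (d : ℤ) ≠ 0 := by exact_mod_cast h0.ne'
    apply mul_left_cancel₀ hd
    have ha' : (m : ℤ) = d * a := by exact_mod_cast ha
    have hb' : (n : ℤ) = d * b := by exact_mod_cast hb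
    rw [ha', hb'] at hbez
    linear_combination -hbez
  have hcomm : Commute g (g * z) := (Commute.refl g).mul_right hgz
  refine ⟨b * t, orderOf_dvd_of_pow_eq_one ?_⟩
  have hsplit : g * z ^ ((b : ℤ) * t) = g ^ ((a : ℤ) * s) * (g * z) ^ ((b : ℤ) * t) := by
    rw [hgz.mul_zpow, ← mul_assoc, ← zpow_add, hab, zpow_one]
  rw [hsplit, (hcomm.zpow_zpow _ _).mul_pow, ← zpow_natCast, ← zpow_natCast, ← zpow_mul,
    ← zpow_mul]
  have h1 : (a : ℤ) * s * d = (m : ℤ) * s := by rw [ha]; push_cast; ring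
  have h2 : (b : ℤ) * t * d = (n : ℤ) * t := by rw [hb]; push_cast; ring
  rw [h1, h2, zpow_mul, zpow_mul, zpow_natCast, zpow_natCast, hm, hn, pow_orderOf_eq_one,
    pow_orderOf_eq_one, one_zpow, one_zpow, one_mul]

/-- If `g` has minimal order in its coset modulo the center, then the order of a central `z`
divides the order of `g * z`. -/
theorem orderOf_dvd_orderOf_mul_of_minimal {G : Type*} [Group G] [Finite G] {g : G}
    (hg : ∀ z : Subgroup.center G, orderOf g ≤ orderOf (g * z)) (z : Subgroup.center G) :
    orderOf z ∣ orderOf (g * z) := by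
  have hgz : Commute g (z : G) := Subgroup.mem_center_iff.1 z.2 g
  obtain ⟨k, hk⟩ := hgz.exists_orderOf_mul_zpow_dvd_gcd
  have hle : orderOf g ≤ (orderOf g).gcd (orderOf (g * z)) :=
    (hg (z ^ k)).trans (Nat.le_of_dvd (Nat.gcd_pos_of_pos_left _ (orderOf_pos g)) (by simpa using hk))
  have hdvd : orderOf g ∣ orderOf (g * z) :=
    Nat.gcd_eq_left_iff_dvd.1 ((Nat.gcd_le_left _ (orderOf_pos g)).antisymm hle)
  rw [← Subgroup.orderOf_coe]
  apply orderOf_dvd_of_pow_eq_one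
  have h1 := pow_orderOf_eq_one (g * (z : G))
  rwa [hgz.mul_pow, orderOf_dvd_iff_pow_eq_one.1 hdvd, one_mul] at h1

/-- Among the cosets of the center, the sum of `1 / φ(o(x))` is largest on the center itself. -/
theorem sum_inv_totient_mul_center_le {G : Type*} [Group G] [Finite G]
    [Fintype (Subgroup.center G)] (x : G) :
    ∑ z : Subgroup.center G, ((orderOf (x * z)).totient : ℚ)⁻¹ ≤
        ∑ z : Subgroup.center G, ((orderOf z).totient : ℚ)⁻¹ ∧
      (∑ z : Subgroup.center G, ((orderOf (x * z)).totient : ℚ)⁻¹ =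
          ∑ z : Subgroup.center G, ((orderOf z).totient : ℚ)⁻¹ →
        ∃ z : Subgroup.center G, (x * z) ^ 2 = 1) := by
  obtain ⟨w, hw⟩ := Finite.exists_min fun z : Subgroup.center G => orderOf (x * z)
  have hmin : ∀ z : Subgroup.center G, orderOf (x * w) ≤ orderOf (x * w * z) := fun z => by
    simpa [mul_assoc] using hw (w * z)
  have hshift : ∑ z : Subgroup.center G, ((orderOf (x * z)).totient : ℚ)⁻¹ =
      ∑ z : Subgroup.center G, ((orderOf (x * w * z)).totient : ℚ)⁻¹ := by
    rw [← Equiv.sum_comp (Equiv.mulLeft w)]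
    simp [mul_assoc]
  have hle : ∀ z ∈ (Finset.univ : Finset (Subgroup.center G)),
      ((orderOf (x * w * z)).totient : ℚ)⁻¹ ≤ ((orderOf z).totient : ℚ)⁻¹ := fun z _ => by
    have hpos : 0 < (orderOf z).totient := Nat.totient_pos.2 (orderOf_pos z)
    have hpos' : 0 < (orderOf (x * w * z)).totient := Nat.totient_pos.2 (orderOf_pos _)
    apply inv_anti₀ (by exact_mod_cast hpos)
    exact_mod_cast Nat.le_of_dvd hpos'
      (Nat.totient_dvd_of_dvd (orderOf_dvd_orderOf_mul_of_minimal hmin z))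
  rw [hshift]
  refine ⟨Finset.sum_le_sum hle, fun heq => ⟨w, ?_⟩⟩
  have h1 := (Finset.sum_eq_sum_iff_of_le hle).1 heq 1 (Finset.mem_univ _)
  have h2 : (orderOf (x * w)).totient = 1 := by simpa using h1
  apply orderOf_dvd_iff_pow_eq_one.1
  rcases Nat.totient_eq_one_iff.1 h2 with h | h <;> simp [h]

/-- If `α(G) = α(Z(G))`, then every coset of the center contains an element of order at most
two. -/
theorem exists_mul_center_sq_eq_one_of_alpha_eq {G : Type*} [Group G] [Finite G]
    (h : alpha G = alpha (Subgroup.center G)) (x : G) :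
    ∃ z : Subgroup.center G, (x * z) ^ 2 = 1 := by
  have := Fintype.ofFinite G
  have := Fintype.ofFinite (Subgroup.center G)
  refine (sum_inv_totient_mul_center_le x).2 ?_
  refine (Finset.sum_eq_sum_iff_of_le (s := Finset.univ)
    fun y (_ : y ∈ Finset.univ) => (sum_inv_totient_mul_center_le y).1).1 ?_ x (Finset.mem_univ x)
  have hshift : ∀ z : Subgroup.center G, ∑ y : G, ((orderOf (y * z)).totient : ℚ)⁻¹ =
      ∑ y : G, ((orderOf y).totient : ℚ)⁻¹ := fun z =>
    Equiv.sum_comp (Equiv.mulRight (z : G)) fun y => ((orderOf y).totient : ℚ)⁻¹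
  rw [Finset.sum_comm, Finset.sum_congr rfl fun z _ => hshift z, Finset.sum_const,
    Finset.sum_const, nsmul_eq_mul, nsmul_eq_mul, Finset.card_univ, Finset.card_univ]
  rw [alpha, alpha, card_isCyclic_subgroup_eq_sum, card_isCyclic_subgroup_eq_sum,
    Nat.card_eq_fintype_card, Nat.card_eq_fintype_card,
    div_eq_div_iff (by exact_mod_cast Fintype.card_ne_zero)
      (by exact_mod_cast Fintype.card_ne_zero)] at h
  linarith

/-- If `α(G) = α(Z(G))`, then for every odd prime `p` every Sylow `p`-subgroup of `G`
is contained in the center. -/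
theorem sylow_le_center_of_alpha_eq (G : Type*) [Group G] [Finite G]
    (h : alpha G = alpha (Subgroup.center G)) :
    ∀ (p : ℕ), p.Prime → Odd p → ∀ P : Sylow p G, (P : Subgroup G) ≤ Subgroup.center G := by
  intro p _ hodd P x hx
  obtain ⟨z, hz⟩ := exists_mul_center_sq_eq_one_of_alpha_eq h x
  have hcomm : Commute x (z : G) := Subgroup.mem_center_iff.1 z.2 x
  have hx2 : x ^ 2 ∈ Subgroup.center G := by
    rw [hcomm.mul_pow] at hz
    rw [eq_inv_of_mul_eq_one_left hz]
    exact inv_mem (pow_mem z.2 2)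
  obtain ⟨k, hk⟩ := P.isPGroup' ⟨x, hx⟩
  have hxk : x ^ p ^ k = 1 := congrArg Subtype.val hk
  obtain ⟨m, hm⟩ := hodd.pow (n := k)
  rw [hm, pow_succ, pow_mul] at hxk
  rw [eq_inv_of_mul_eq_one_right hxk]
  exact inv_mem (pow_mem hx2 m)
end
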